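/- Let κ be an infinite cardinal with 2^κ = κ⁺. Then there exists a universal graph on κ⁺, i.e., a simple graph G on a vertex set of cardinality κ⁺ such that every simple graph on a vertex set of cardinality κ⁺ admits an embedding into G as an induced subgraph. -/

import Mathlib

universe u

/-- If `2^κ = κ⁺` for an infinite cardinal `κ`, then there is a universal graph on `κ⁺`:
a simple graph `G` on a vertex set of cardinality `κ⁺` such that every simple graph on a
vertex set of cardinality `κ⁺` embeds into `G` as an induced subgraph. -/
theorem universal_graph_of_two_pow_eq_succ (κ : Cardinal.{u})
    (hκ : Cardinal.aleph0 ≤ κ) (h : (2 : Cardinal.{u}) ^ κ = Order.succ κ) :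
    ∃ (V : Type u) (G : SimpleGraph V), Cardinal.mk V = Order.succ κ ∧
      ∀ (W : Type u) (H : SimpleGraph W), Cardinal.mk W = Order.succ κ →
        Nonempty (H ↪g G) := by
  have hI : Cardinal.mk (Order.succ κ).ord.ToType = Order.succ κ := by simp
  have hs : Cardinal.aleph0 ≤ Order.succ κ := hκ.trans (Order.le_succ κ)
  have hlt : ∀ a : (Order.succ κ).ord.ToType, Cardinal.mk (Set.Iio a) ≤ κ := fun a =>
    Order.lt_succ_iff.1 (Cardinal.mk_Iio_toType_ord_lt a)
  refine ⟨Σ a : (Order.succ κ).ord.ToType, Set (Set.Iio a),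
    { Adj := fun x y => (∃ hh : x.1 < y.1, (⟨x.1, hh⟩ : Set.Iio y.1) ∈ y.2) ∨
        (∃ hh : y.1 < x.1, (⟨y.1, hh⟩ : Set.Iio x.1) ∈ x.2)
      symm := ⟨fun x y hxy => hxy.symm⟩
      loopless := ⟨fun x hx => by
        rcases hx with ⟨hh, _⟩ | ⟨hh, _⟩ <;> exact lt_irrefl _ hh⟩ }, ?_, ?_⟩
  · apply le_antisymm
    · rw [Cardinal.mk_sigma]
      calc _ ≤ Cardinal.sum (fun _ : (Order.succ κ).ord.ToType => Order.succ κ) := by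
            apply Cardinal.sum_le_sum
            intro a
            rw [Cardinal.mk_set]
            exact (Cardinal.power_le_power_left two_ne_zero (hlt a)).trans h.le
        _ = Order.succ κ := by
            rw [Cardinal.sum_const', hI, Cardinal.mul_eq_self hs]
    · refine hI.symm.le.trans ?_
      exact Cardinal.mk_le_of_injective
        (f := fun a => (⟨a, ∅⟩ : Σ a : (Order.succ κ).ord.ToType, Set (Set.Iio a)))
        (fun a b hab => congrArg Sigma.fst hab)
  · intro W H hW
    obtain ⟨e⟩ := Cardinal.eq.1 (hW.trans hI.symm)
    refine ⟨⟨⟨fun w => ⟨e w, {x | H.Adj (e.symm x.1) w}⟩, fun a b hab =>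
      e.injective (congrArg Sigma.fst hab)⟩, ?_⟩⟩
    intro a b
    constructor
    · rintro (⟨_, hh⟩ | ⟨_, hh⟩)
      · have h2 : H.Adj (e.symm (e a)) b := hh
        simpa using h2
      · have h2 : H.Adj (e.symm (e b)) a := hh
        simpa using h2.symm
    · intro hab
      rcases lt_trichotomy (e a) (e b) with hl | hl | hl
      · exact Or.inl ⟨hl, show H.Adj (e.symm (e a)) b by simpa using hab⟩
      · exact absurd (e.injective hl) hab.ne
      · exact Or.inr ⟨hl, show H.Adj (e.symm (e b)) a by simpa using hab.symm⟩
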